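/- Let μ_j = σ√(log(2p/j)/n) for j = 1,…,p, and define the SLOPE norm |u|_* = ∑_{j=1}^p μ_j u_j*, where u₁* ≥ … ≥ u_p* is the non-increasing rearrangement of |u₁|,…,|u_p|. Let 𝕏 ∈ ℝ^{n×p}, f, ξ ∈ ℝⁿ, y = f + ξ, A ≥ 8, and let β̂ be any solution of min_{β∈ℝᵖ}( ‖y − 𝕏β‖² + 2A|β|_* ). Let g_j = (1/√n)e_jᵀ𝕏ᵀξ with non-increasing rearrangement g₁* ≥ … ≥ g_p* of |g₁|,…,|g_p|. On the event Ω* = ∩_{j=1}^p { g_j* ≤ 4σ√(log(2p/j)) }, one has ‖𝕏β̂ − f‖² ≤ min over s ∈ {1,…,p} of [ min_{β∈ℝᵖ: |β|₀ ≤ s} ‖𝕏β − f‖² + 9A²σ²s log(2ep/s)/(4n ϑ²(s,3)) ], with the convention a/0 = +∞ for a > 0. -/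

import Mathlib

open MeasureTheory
open scoped ENNReal

/-- The scaled Euclidean norm `‖u‖ = sqrt((1/n) ∑ u_i²)` on `ℝⁿ`. -/
noncomputable def scaledNorm {n : ℕ} (u : Fin n → ℝ) : ℝ :=
  Real.sqrt ((∑ i, u i ^ 2) / n)

/-- `rearr u j` is the `(j+1)`-th largest value among `|u₁|,…,|u_p|`
(the non-increasing rearrangement `u*`, `0`-indexed). -/
noncomputable def rearr {p : ℕ} (u : Fin p → ℝ) (j : Fin p) : ℝ :=
  ((Finset.univ.val.map fun i => |u i|).sort (· ≥ ·)).getD j 0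

/-- The SLOPE weights `μ_j = σ √(log(2p/j)/n)` (`0`-indexed: `j+1` plays the role of `j`). -/
noncomputable def muW (σ : ℝ) (n : ℕ) {p : ℕ} (j : Fin p) : ℝ :=
  σ * Real.sqrt (Real.log (2 * p / ((j : ℕ) + 1)) / n)

/-- The SLOPE norm `|u|_* = ∑_j μ_j u_j*`. -/
noncomputable def slopeNorm (σ : ℝ) (n : ℕ) {p : ℕ} (u : Fin p → ℝ) : ℝ :=
  ∑ j, muW σ n j * rearr u j

/-- The squared Weighted Restricted Eigenvalue constant `ϑ²(s,c₀)`. -/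
noncomputable def thetaSq {n p : ℕ} (X : Matrix (Fin n) (Fin p) ℝ) (σ : ℝ)
    (s : ℕ) (c₀ : ℝ) : ℝ :=
  sInf {r | ∃ Δ : Fin p → ℝ, Δ ≠ 0 ∧
    (∑ j ∈ Finset.univ.filter (fun j : Fin p => s ≤ (j : ℕ)), muW σ n j * rearr Δ j)
      ≤ c₀ * Real.sqrt (∑ j ∈ Finset.univ.filter (fun j : Fin p => (j : ℕ) < s),
            muW σ n j ^ 2) * Real.sqrt (∑ j, Δ j ^ 2) ∧
    r = scaledNorm (X.mulVec Δ) ^ 2 / ∑ j, Δ j ^ 2}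

lemma exists_perm_rearr {p : ℕ} (u : Fin p → ℝ) :
    ∃ φ : Equiv.Perm (Fin p), (∀ k, rearr u k = |u (φ k)|) ∧ Antitone (rearr u) := by
  set φ := Tuple.sort (fun i => -|u i|) with hφ
  have hmono : Monotone ((fun i => -|u i|) ∘ φ) := Tuple.monotone_sort _
  have hanti : Antitone (fun k => |u (φ k)|) := fun i j hij => neg_le_neg_iff.1 (hmono hij)
  have hlist : (Finset.univ.val.map fun i => |u i|).sort (· ≥ ·)
      = List.ofFn (fun k => |u (φ k)|) := by
    refine List.Perm.eq_of_pairwise' (r := (· ≥ ·)) (Multiset.pairwise_sort _ _) ?_ ?_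
    · rw [List.pairwise_ofFn]
      exact fun i j hij => hanti hij.le
    · rw [← Multiset.coe_eq_coe, Multiset.sort_eq, ← Fin.univ_val_map,
        show (fun k => |u (φ k)|) = (fun i => |u i|) ∘ φ from rfl, ← Multiset.map_map]
      congr 1
      have h := congrArg Finset.val (Finset.map_univ_equiv φ)
      rw [Finset.map_val] at h
      exact h.symm
  have hval : ∀ k, rearr u k = |u (φ k)| := fun k => by
    unfold rearr
    rw [hlist, List.getD_eq_getElem _ _ (by simp)]
    simp
  exact ⟨φ, hval, fun i j hij => by rw [hval, hval]; exact hanti hij⟩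

lemma rearr_nonneg {p : ℕ} (u : Fin p → ℝ) (k : Fin p) : 0 ≤ rearr u k := by
  obtain ⟨φ, h, -⟩ := exists_perm_rearr u
  rw [h]
  positivity

/-- Rearrangement inequality against antitone weights. -/
lemma sum_mul_abs_perm_le {p : ℕ} {w : Fin p → ℝ} (hw : Antitone w) (u : Fin p → ℝ)
    (π : Equiv.Perm (Fin p)) : ∑ k, w k * |u (π k)| ≤ ∑ k, w k * rearr u k := by
  obtain ⟨φ, h, hanti⟩ := exists_perm_rearr u
  have key := (hw.monovary hanti).sum_mul_comp_perm_le_sum_mul (σ := π.trans φ.symm)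
  simpa [h] using key

lemma sum_mul_le_rearr {p : ℕ} (u v : Fin p → ℝ) :
    ∑ i, u i * v i ≤ ∑ k, rearr u k * rearr v k := by
  obtain ⟨φ, h, hanti⟩ := exists_perm_rearr u
  calc ∑ i, u i * v i = ∑ k, u (φ k) * v (φ k) := (Equiv.sum_comp φ fun i => u i * v i).symm
    _ ≤ ∑ k, rearr u k * |v (φ k)| := by
        refine Finset.sum_le_sum fun k _ => ?_
        rw [h, ← abs_mul]
        exact le_abs_self _
    _ ≤ _ := sum_mul_abs_perm_le hanti v φ

lemma muW_nonneg {σ : ℝ} (hσ : 0 < σ) (n : ℕ) {p : ℕ} (j : Fin p) : 0 ≤ muW σ n j := by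
  unfold muW
  positivity

lemma muW_antitone {σ : ℝ} (hσ : 0 < σ) (n p : ℕ) :
    Antitone (muW σ n : Fin p → ℝ) := by
  intro i j hij
  have hp : (0 : ℝ) < p := by exact_mod_cast i.pos
  have hij' : ((i : ℕ) : ℝ) ≤ (j : ℕ) := by exact_mod_cast hij
  unfold muW
  gcongr

lemma slopeNorm_convexComb_le {σ : ℝ} (hσ : 0 < σ) (n : ℕ) {p : ℕ} (a b : Fin p → ℝ) {t : ℝ}
    (h0 : 0 ≤ t) (h1 : t ≤ 1) :
    slopeNorm σ n (fun i => (1 - t) * a i + t * b i)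
      ≤ (1 - t) * slopeNorm σ n a + t * slopeNorm σ n b := by
  obtain ⟨φ, h, -⟩ := exists_perm_rearr (fun i => (1 - t) * a i + t * b i)
  have ha := sum_mul_abs_perm_le (muW_antitone hσ n p) a φ
  have hb := sum_mul_abs_perm_le (muW_antitone hσ n p) b φ
  have h1' : 0 ≤ 1 - t := by linarith
  calc slopeNorm σ n (fun i => (1 - t) * a i + t * b i)
      ≤ ∑ k, ((1 - t) * (muW σ n k * |a (φ k)|) + t * (muW σ n k * |b (φ k)|)) := by
        refine Finset.sum_le_sum fun k _ => ?_
        rw [h]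
        have := abs_add_le ((1 - t) * a (φ k)) (t * b (φ k))
        rw [abs_mul, abs_mul, abs_of_nonneg h0, abs_of_nonneg h1'] at this
        nlinarith [muW_nonneg hσ n k]
    _ = (1 - t) * (∑ k, muW σ n k * |a (φ k)|) + t * ∑ k, muW σ n k * |b (φ k)| := by
        rw [Finset.sum_add_distrib, Finset.mul_sum, Finset.mul_sum]
    _ ≤ _ := by
        unfold slopeNorm
        gcongr

/-- The first `s` values of a permutation extend to a permutation that does not increase any
later index. -/
lemma exists_perm_eq_and_le {p : ℕ} (s : ℕ) (α : Equiv.Perm (Fin p)) :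
    ∃ ρ : Equiv.Perm (Fin p), (∀ k : Fin p, (k : ℕ) < s → ρ k = α k) ∧
      ∀ k : Fin p, s ≤ (k : ℕ) → ρ k ≤ k := by
  classical
  set S : Finset (Fin p) := Finset.univ.filter fun k =>
    (k : ℕ) < s ∨ ∀ j : Fin p, (j : ℕ) < s → α j ≠ k with hS
  set F : Fin p → Fin p := fun k => if (k : ℕ) < s then α k else k with hF
  have hmem : ∀ k, k ∈ S ↔ (k : ℕ) < s ∨ ∀ j : Fin p, (j : ℕ) < s → α j ≠ k := by simp [hS]
  have hinj : Set.InjOn F S := by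
    intro i hi j hj hij
    rw [Finset.mem_coe, hmem] at hi hj
    simp only [hF] at hij
    split_ifs at hij with h1 h2 h2
    · exact α.injective hij
    · exact absurd hij ((hj.resolve_left h2) i h1)
    · exact absurd hij.symm ((hi.resolve_left h1) j h2)
    · exact hij
  obtain ⟨g, hg⟩ := Finset.exists_equiv_extend_of_card_eq (t := Finset.univ) (by simp)
    (Finset.subset_univ (S.image F)) hinj
  set ρ : Equiv.Perm (Fin p) := g.trans (Equiv.subtypeUnivEquiv (by simp)) with hρ
  have hρS : ∀ k ∈ S, ρ k = F k := fun k hk => hg k hk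
  refine ⟨ρ, fun k hk => ?_, fun k hk => ?_⟩
  · rw [hρS k ((hmem k).2 (Or.inl hk))]
    simp [hF, hk]
  · by_cases hkS : k ∈ S
    · rw [hρS k hkS]
      simp [hF, hk.not_gt]
    · by_contra! hlt
      have hs : s ≤ (ρ k : ℕ) := hk.trans hlt.le
      by_cases hj : ∃ j : Fin p, (j : ℕ) < s ∧ α j = ρ k
      · obtain ⟨j, hjs, hj⟩ := hj
        have hjS := (hmem j).2 (Or.inl hjs)
        have : ρ j = ρ k := by rw [hρS j hjS, ← hj]; simp [hF, hjs]
        exact hkS (ρ.injective this ▸ hjS)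
      · push Not at hj
        have hS' := (hmem (ρ k)).2 (Or.inr hj)
        have : ρ (ρ k) = ρ k := by rw [hρS _ hS']; simp [hF, hs.not_gt]
        exact hlt.ne' (ρ.injective this)

lemma rearr_eq_zero_of_sparse {p : ℕ} {β : Fin p → ℝ} {s : ℕ} (hβ : {j | β j ≠ 0}.ncard ≤ s)
    {k : Fin p} (hk : s ≤ (k : ℕ)) : rearr β k = 0 := by
  obtain ⟨φ, h, hanti⟩ := exists_perm_rearr β
  by_contra hne
  have hpos : 0 < rearr β k := lt_of_le_of_ne (rearr_nonneg β k) (Ne.symm hne)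
  have hsub : φ '' (Set.Iic k) ⊆ {j | β j ≠ 0} := by
    rintro _ ⟨i, hi, rfl⟩
    have := hpos.trans_le (hanti hi)
    rw [h] at this
    exact abs_pos.1 this
  have := Set.ncard_le_ncard hsub (Set.toFinite _)
  rw [Set.ncard_image_of_injective _ φ.injective, ← Finset.coe_Iic, Set.ncard_coe_finset,
    Fin.card_Iic] at this
  omega

lemma sum_eq_sum_lt_add_sum_ge {p : ℕ} (s : ℕ) (F : Fin p → ℝ) :
    ∑ k, F k = ∑ k : Fin p with k.val < s, F k + ∑ k : Fin p with s ≤ k.val, F k := by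
  rw [← Finset.sum_filter_add_sum_filter_not Finset.univ (fun k : Fin p => (k : ℕ) < s)]
  simp only [not_lt]

lemma slopeNorm_sub_slopeNorm_add_le {σ : ℝ} (hσ : 0 < σ) (n : ℕ) {p : ℕ} {β Δ : Fin p → ℝ}
    {s : ℕ} (hβ : {j | β j ≠ 0}.ncard ≤ s) :
    slopeNorm σ n β - slopeNorm σ n (β + Δ)
      ≤ ∑ k : Fin p with k.val < s, muW σ n k * rearr Δ k
        - ∑ k : Fin p with s ≤ k.val, muW σ n k * rearr Δ k := by
  obtain ⟨φ, hφ, -⟩ := exists_perm_rearr β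
  obtain ⟨d, hd, hanti⟩ := exists_perm_rearr Δ
  obtain ⟨ρ, hρ1, hρ2⟩ := exists_perm_eq_and_le s (φ.trans d.symm)
  set ψ : Equiv.Perm (Fin p) := ρ.trans d with hψ
  have hψ1 : ∀ k : Fin p, (k : ℕ) < s → ψ k = φ k := fun k hk => by simp [hψ, hρ1 k hk]
  have hψ2 : ∀ k : Fin p, s ≤ (k : ℕ) → rearr Δ k ≤ |Δ (ψ k)| := fun k hk => by
    have := hanti (hρ2 k hk)
    rwa [hd (ρ k)] at this
  have hψ3 : ∀ k : Fin p, s ≤ (k : ℕ) → β (ψ k) = 0 := fun k hk => by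
    have hz := rearr_eq_zero_of_sparse hβ (k := φ.symm (ψ k)) (by
      by_contra! hlt
      have h := hψ1 _ hlt
      rw [Equiv.apply_symm_apply] at h
      rw [ψ.injective h] at hlt
      omega)
    rw [hφ, Equiv.apply_symm_apply] at hz
    exact abs_eq_zero.1 hz
  have hβn : slopeNorm σ n β = ∑ k : Fin p with k.val < s, muW σ n k * |β (ψ k)| := by
    unfold slopeNorm
    rw [sum_eq_sum_lt_add_sum_ge s, Finset.sum_eq_zero (s := Finset.univ.filter fun k : Fin p =>
      s ≤ (k : ℕ)), add_zero]
    · refine Finset.sum_congr rfl fun k hk => ?_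
      rw [hφ, hψ1 k (by simpa using hk)]
    · intro k hk
      rw [rearr_eq_zero_of_sparse hβ (by simpa using hk), mul_zero]
  have hsum := sum_mul_abs_perm_le (muW_antitone hσ n p) (β + Δ) ψ
  rw [sum_eq_sum_lt_add_sum_ge s] at hsum
  have hge : ∑ k : Fin p with s ≤ k.val, muW σ n k * rearr Δ k
      ≤ ∑ k : Fin p with s ≤ k.val, muW σ n k * |(β + Δ) (ψ k)| := by
    refine Finset.sum_le_sum fun k hk => ?_
    have hk' : s ≤ (k : ℕ) := by simpa using hk
    rw [Pi.add_apply, hψ3 k hk', zero_add]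
    exact mul_le_mul_of_nonneg_left (hψ2 k hk') (muW_nonneg hσ n k)
  have hlt : ∑ k : Fin p with k.val < s, muW σ n k * |β (ψ k)|
      ≤ ∑ k : Fin p with k.val < s, muW σ n k * |(β + Δ) (ψ k)|
        + ∑ k : Fin p with k.val < s, muW σ n k * |Δ (ψ k)| := by
    rw [← Finset.sum_add_distrib]
    refine Finset.sum_le_sum fun k _ => ?_
    rw [← mul_add]
    refine mul_le_mul_of_nonneg_left ?_ (muW_nonneg hσ n k)
    have := abs_sub ((β + Δ) (ψ k)) (Δ (ψ k))
    simpa using this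
  have hw : Antitone fun k : Fin p => if (k : ℕ) < s then muW σ n k else 0 := by
    intro i j hij
    have hij' : (i : ℕ) ≤ j := hij
    dsimp only
    split_ifs with h1 h2
    · exact muW_antitone hσ n p hij
    · omega
    · exact muW_nonneg hσ n i
    · exact le_rfl
  have htop := sum_mul_abs_perm_le hw Δ ψ
  simp only [ite_mul, zero_mul, ← Finset.sum_filter] at htop
  have hβΔ : slopeNorm σ n (β + Δ) = ∑ k, muW σ n k * rearr (β + Δ) k := rfl
  linarith

lemma scaledNorm_sq {n : ℕ} (u : Fin n → ℝ) : scaledNorm u ^ 2 = (∑ i, u i ^ 2) / n := by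
  unfold scaledNorm
  rw [Real.sq_sqrt]
  positivity

/-- First-order optimality of a penalized least squares solution, with a convex penalty. -/
lemma sq_sub_le_of_isMin {n p : ℕ} (hn : 0 < n) {σ : ℝ} (hσ : 0 < σ)
    {X : Matrix (Fin n) (Fin p) ℝ} {f ξ y : Fin n → ℝ} (hy : y = f + ξ) {A : ℝ} (hA : 0 ≤ A)
    {b : Fin p → ℝ}
    (hmin : ∀ c : Fin p → ℝ,
      scaledNorm (y - X.mulVec b) ^ 2 + 2 * A * slopeNorm σ n b
        ≤ scaledNorm (y - X.mulVec c) ^ 2 + 2 * A * slopeNorm σ n c) (β : Fin p → ℝ) :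
    scaledNorm (X.mulVec b - f) ^ 2 + scaledNorm (X.mulVec (b - β)) ^ 2
      ≤ scaledNorm (X.mulVec β - f) ^ 2 + 2 * ((∑ i, ξ i * X.mulVec (b - β) i) / n)
        + 2 * A * (slopeNorm σ n β - slopeNorm σ n b) := by
  have hn' : (0 : ℝ) < n := by exact_mod_cast hn
  set D := X.mulVec (b - β) with hD
  have hβD : ∀ i, X.mulVec β i = X.mulVec b i - D i := fun i => by
    rw [hD, Matrix.mulVec_sub, Pi.sub_apply]
    ring
  set C := ∑ i, (y i - X.mulVec b i) * D i with hC
  set B := ∑ i, D i ^ 2 with hB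
  have hstep : ∀ t : ℝ, 0 < t → t ≤ 1 →
      -(2 * C) / n ≤ 2 * A * (slopeNorm σ n β - slopeNorm σ n b) + t * (B / n) := by
    intro t ht0 ht1
    have h := hmin (fun i => (1 - t) * b i + t * β i)
    have hconv := mul_le_mul_of_nonneg_left (slopeNorm_convexComb_le hσ n b β ht0.le ht1)
      (by positivity : 0 ≤ 2 * A)
    have hX : X.mulVec (fun i => (1 - t) * b i + t * β i) = X.mulVec b - t • D := by
      rw [hD, ← Matrix.mulVec_smul, ← Matrix.mulVec_sub]
      congr 1
      ext i
      simp only [Pi.sub_apply, Pi.smul_apply, smul_eq_mul]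
      ring
    have hexp : ∑ i, (y - X.mulVec (fun i => (1 - t) * b i + t * β i)) i ^ 2
        = ∑ i, (y - X.mulVec b) i ^ 2 + 2 * t * C + t ^ 2 * B := by
      rw [hX, hC, hB, Finset.mul_sum, Finset.mul_sum, ← Finset.sum_add_distrib,
        ← Finset.sum_add_distrib]
      refine Finset.sum_congr rfl fun i _ => ?_
      simp only [Pi.sub_apply, Pi.smul_apply, smul_eq_mul]
      ring
    rw [scaledNorm_sq, scaledNorm_sq, hexp, add_div, add_div] at h
    have h2 : t * (-(2 * C) / n)
        ≤ t * (2 * A * (slopeNorm σ n β - slopeNorm σ n b) + t * (B / n)) := by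
      have e1 : t * (-(2 * C) / n) = -(2 * t * C / n) := by ring
      have e2 : t ^ 2 * B / n = t * (t * (B / n)) := by ring
      rw [e1]
      rw [e2] at h
      linarith
    exact le_of_mul_le_mul_left h2 ht0
  have hlim : -(2 * C) / n ≤ 2 * A * (slopeNorm σ n β - slopeNorm σ n b) := by
    have hBn : 0 ≤ B / n := by positivity
    refine le_of_forall_pos_le_add fun ε hε => ?_
    have hpos : 0 < B / n + 1 := by linarith
    refine (hstep (min 1 (ε / (B / n + 1))) (by positivity) (min_le_left _ _)).trans ?_
    have : min 1 (ε / (B / n + 1)) * (B / n) ≤ ε / (B / n + 1) * (B / n + 1) :=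
      mul_le_mul (min_le_right _ _) (by linarith) hBn (by positivity)
    rw [div_mul_cancel₀ _ hpos.ne'] at this
    linarith
  have hid : ∑ i, (X.mulVec b - f) i ^ 2 + B
      = ∑ i, (X.mulVec β - f) i ^ 2 + 2 * (∑ i, ξ i * D i) + -(2 * C) := by
    rw [hB, hC, Finset.mul_sum, Finset.mul_sum, ← Finset.sum_neg_distrib,
      ← Finset.sum_add_distrib, ← Finset.sum_add_distrib, ← Finset.sum_add_distrib]
    refine Finset.sum_congr rfl fun i _ => ?_
    simp only [Pi.sub_apply, hβD, hy, Pi.add_apply]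
    ring
  have hid' := congrArg (· / (n : ℝ)) hid
  simp only [add_div, mul_div_assoc] at hid'
  rw [scaledNorm_sq, scaledNorm_sq, scaledNorm_sq]
  linarith

lemma noise_le {n p : ℕ} {σ : ℝ} {X : Matrix (Fin n) (Fin p) ℝ} {ξ : Fin n → ℝ}
    (hevent : ∀ j : Fin p,
      rearr (fun j' => (1 / Real.sqrt n) * X.transpose.mulVec ξ j') j
        ≤ 4 * σ * Real.sqrt (Real.log (2 * p / ((j : ℕ) + 1)))) (Δ : Fin p → ℝ) :
    (∑ i, ξ i * X.mulVec Δ i) / n ≤ 4 * slopeNorm σ n Δ := by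
  have h := sum_mul_le_rearr (fun j' => (1 / Real.sqrt n) * X.transpose.mulVec ξ j') Δ
  have hdual : ∑ i, ξ i * X.mulVec Δ i = ∑ j, X.transpose.mulVec ξ j * Δ j := by
    rw [Matrix.mulVec_transpose]
    exact Matrix.dotProduct_mulVec ξ X Δ
  calc (∑ i, ξ i * X.mulVec Δ i) / n
      = 1 / Real.sqrt n * ∑ j, (1 / Real.sqrt n) * X.transpose.mulVec ξ j * Δ j := by
        simp only [mul_assoc]
        rw [hdual, ← Finset.mul_sum, ← mul_assoc, div_mul_div_comm,
          Real.mul_self_sqrt (Nat.cast_nonneg n)]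
        ring
    _ ≤ 1 / Real.sqrt n * ∑ k : Fin p, 4 * σ * Real.sqrt (Real.log (2 * p / ((k : ℕ) + 1)))
          * rearr Δ k := by
        refine mul_le_mul_of_nonneg_left (h.trans ?_) (by positivity)
        exact Finset.sum_le_sum fun k _ =>
          mul_le_mul_of_nonneg_right (hevent k) (rearr_nonneg Δ k)
    _ = 4 * slopeNorm σ n Δ := by
        unfold slopeNorm muW
        rw [Finset.mul_sum, Finset.mul_sum]
        refine Finset.sum_congr rfl fun k _ => ?_
        rw [Real.sqrt_div' _ (Nat.cast_nonneg n)]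
        ring

lemma sum_log_le {p s : ℕ} (hs : 1 ≤ s) (hsp : s ≤ p) :
    ∑ k ∈ Finset.range s, Real.log (2 * p / ((k : ℝ) + 1))
      ≤ s * Real.log (2 * Real.exp 1 * p / s) := by
  have hs' : (0 : ℝ) < s := by exact_mod_cast hs
  have hp' : (0 : ℝ) < p := by exact_mod_cast hs.trans hsp
  have hfac : ∀ m : ℕ, ∑ k ∈ Finset.range m, Real.log (2 * p / ((k : ℝ) + 1))
      = m * Real.log (2 * p) - Real.log (m.factorial : ℝ) := by
    intro m
    induction m with
    | zero => simp
    | succ m ih =>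
      have hm : ((m.factorial : ℕ) : ℝ) ≠ 0 := by exact_mod_cast m.factorial_ne_zero
      rw [Finset.sum_range_succ, ih, Nat.factorial_succ, Nat.cast_mul, Nat.cast_succ,
        Real.log_mul (by positivity) hm, Real.log_div (by positivity) (by positivity)]
      ring
  have hst : s * Real.log s - s ≤ Real.log (s.factorial : ℝ) := by
    have hfpos : (0 : ℝ) < s.factorial := by exact_mod_cast s.factorial_pos
    have h := Real.log_le_log (by positivity) (Real.pow_div_factorial_le_exp (s : ℝ) hs'.le s)
    rw [Real.log_exp, Real.log_div (by positivity) hfpos.ne', Real.log_pow] at h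
    linarith
  rw [hfac, Real.log_div (by positivity) hs'.ne', mul_right_comm,
    Real.log_mul (by positivity) (Real.exp_ne_zero 1), Real.log_exp]
  linarith

lemma sum_muW_sq_le {n p s : ℕ} (σ : ℝ) (hs : 1 ≤ s) (hsp : s ≤ p) :
    ∑ k : Fin p with k.val < s, muW σ n k ^ 2
      ≤ σ ^ 2 * s * Real.log (2 * Real.exp 1 * p / s) / n := by
  have hterm : ∀ k : Fin p, muW σ n k ^ 2
      = σ ^ 2 / n * Real.log (2 * p / (((k : ℕ) : ℝ) + 1)) := by
    intro k
    have hk : ((k : ℕ) : ℝ) + 1 ≤ p := by exact_mod_cast k.isLt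
    have hlog : 0 ≤ Real.log (2 * p / (((k : ℕ) : ℝ) + 1)) := by
      refine Real.log_nonneg ?_
      rw [le_div_iff₀ (by positivity)]
      linarith [(Nat.cast_nonneg p : (0 : ℝ) ≤ p)]
    unfold muW
    rw [mul_pow, Real.sq_sqrt (by positivity)]
    ring
  have hrange : ∑ k : Fin p with k.val < s, Real.log (2 * p / (((k : ℕ) : ℝ) + 1))
      = ∑ k ∈ Finset.range s, Real.log (2 * p / ((k : ℝ) + 1)) := by
    rw [Finset.sum_filter, Fin.sum_univ_eq_sum_range
      (fun k => if k < s then Real.log (2 * p / ((k : ℝ) + 1)) else 0) p, ← Finset.sum_filter]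
    congr 1
    ext k
    simp only [Finset.mem_filter, Finset.mem_range]
    omega
  simp only [hterm]
  rw [← Finset.mul_sum, hrange]
  calc _ ≤ σ ^ 2 / n * (s * Real.log (2 * Real.exp 1 * p / s)) :=
        mul_le_mul_of_nonneg_left (sum_log_le hs hsp) (by positivity)
    _ = _ := by ring

lemma sum_muW_mul_rearr_le {n p : ℕ} (σ : ℝ) (s : ℕ) (Δ : Fin p → ℝ) :
    ∑ k : Fin p with k.val < s, muW σ n k * rearr Δ k
      ≤ Real.sqrt (∑ k : Fin p with k.val < s, muW σ n k ^ 2) * Real.sqrt (∑ j, Δ j ^ 2) := by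
  refine (Real.sum_mul_le_sqrt_mul_sqrt _ _ _).trans ?_
  refine mul_le_mul_of_nonneg_left (Real.sqrt_le_sqrt ?_) (Real.sqrt_nonneg _)
  obtain ⟨φ, h, -⟩ := exists_perm_rearr Δ
  calc ∑ k : Fin p with k.val < s, rearr Δ k ^ 2 ≤ ∑ k, rearr Δ k ^ 2 :=
        Finset.sum_le_sum_of_subset_of_nonneg (Finset.filter_subset _ _)
          fun _ _ _ => sq_nonneg _
    _ = ∑ j, Δ j ^ 2 := by
        simp only [h, sq_abs]
        exact Equiv.sum_comp φ fun j => Δ j ^ 2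

lemma thetaSq_mul_le {n p : ℕ} {X : Matrix (Fin n) (Fin p) ℝ} {σ : ℝ} {s : ℕ} {c₀ : ℝ}
    {Δ : Fin p → ℝ}
    (hΔ : (∑ j : Fin p with s ≤ j.val, muW σ n j * rearr Δ j)
      ≤ c₀ * Real.sqrt (∑ j : Fin p with j.val < s, muW σ n j ^ 2)
        * Real.sqrt (∑ j, Δ j ^ 2)) :
    thetaSq X σ s c₀ * ∑ j, Δ j ^ 2 ≤ scaledNorm (X.mulVec Δ) ^ 2 := by
  by_cases h0 : Δ = 0
  · subst h0
    simpa using sq_nonneg _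
  have hpos : 0 < ∑ j, Δ j ^ 2 := by
    obtain ⟨j, hj⟩ := Function.ne_iff.1 h0
    exact Finset.sum_pos' (fun _ _ => sq_nonneg _)
      ⟨j, Finset.mem_univ j, sq_pos_of_ne_zero hj⟩
  rw [← le_div_iff₀ hpos]
  refine csInf_le ⟨0, ?_⟩ ⟨Δ, h0, hΔ, rfl⟩
  rintro _ ⟨Δ', -, -, rfl⟩
  positivity

/-- Sharp oracle inequality for SLOPE on the event
`Ω* = ∩_j {g_j* ≤ 4σ√(log(2p/j))}` where `g = (1/√n)Xᵀξ`.
The oracle bound (with the convention `a/0 = +∞`) is expressed in `ℝ≥0∞`. -/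
theorem stmt17 (n p : ℕ) (hn : 0 < n) (σ : ℝ) (hσ : 0 < σ)
    (X : Matrix (Fin n) (Fin p) ℝ) (f ξ y : Fin n → ℝ) (hy : y = f + ξ)
    (A : ℝ) (hA : 8 ≤ A)
    (βhat : Fin p → ℝ)
    (hmin : ∀ b : Fin p → ℝ,
      scaledNorm (y - X.mulVec βhat) ^ 2 + 2 * A * slopeNorm σ n βhat
        ≤ scaledNorm (y - X.mulVec b) ^ 2 + 2 * A * slopeNorm σ n b)
    (hevent : ∀ j : Fin p,
      rearr (fun j' => (1 / Real.sqrt n) * X.transpose.mulVec ξ j') j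
        ≤ 4 * σ * Real.sqrt (Real.log (2 * p / ((j : ℕ) + 1)))) :
    ENNReal.ofReal (scaledNorm (X.mulVec βhat - f) ^ 2)
      ≤ ⨅ (s : ℕ) (_ : 1 ≤ s) (_ : s ≤ p) (β : Fin p → ℝ)
          (_ : {j | β j ≠ 0}.ncard ≤ s),
          (ENNReal.ofReal (scaledNorm (X.mulVec β - f) ^ 2) +
            ENNReal.ofReal (9 * A ^ 2 * σ ^ 2 * s * Real.log (2 * Real.exp 1 * p / s)) /
              ENNReal.ofReal (4 * n * thetaSq X σ s 3)) := by
  refine le_iInf fun s => le_iInf fun hs => le_iInf fun hsp => le_iInf fun β => le_iInf fun hβ => ?_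
  have hn' : (0 : ℝ) < n := by exact_mod_cast hn
  have hs' : (0 : ℝ) < s := by exact_mod_cast hs
  have hsp' : (s : ℝ) ≤ p := by exact_mod_cast hsp
  have hA0 : 0 < A := by linarith
  have hlog : 0 < Real.log (2 * Real.exp 1 * p / s) := by
    refine Real.log_pos ?_
    rw [lt_div_iff₀ hs']
    nlinarith [Real.add_one_le_exp (1 : ℝ)]
  rcases le_or_gt (thetaSq X σ s 3) 0 with hθ | hθ
  · rw [ENNReal.ofReal_of_nonpos (p := 4 * n * thetaSq X σ s 3)
      (mul_nonpos_of_nonneg_of_nonpos (by positivity) hθ), ENNReal.div_zero, add_top]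
    · exact le_top
    · exact (ENNReal.ofReal_pos.2 (by positivity)).ne'
  rw [← ENNReal.ofReal_div_of_pos (by positivity),
    ← ENNReal.ofReal_add (by positivity) (by positivity)]
  refine ENNReal.ofReal_le_ofReal ?_
  set Δ := βhat - β with hΔ
  have hopt := sq_sub_le_of_isMin hn hσ hy hA0.le hmin β
  have hnoise := noise_le hevent Δ
  have hsplit := slopeNorm_sub_slopeNorm_add_le hσ n (Δ := Δ) hβ
  rw [hΔ, add_sub_cancel, ← hΔ] at hsplit
  have hsum : slopeNorm σ n Δ = _ := sum_eq_sum_lt_add_sum_ge s _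
  have hcs := sum_muW_mul_rearr_le (n := n) σ s Δ
  have hW := sum_muW_sq_le (n := n) σ hs hsp
  have htail : 0 ≤ ∑ k : Fin p with s ≤ k.val, muW σ n k * rearr Δ k :=
    Finset.sum_nonneg fun k _ => mul_nonneg (muW_nonneg hσ n k) (rearr_nonneg Δ k)
  have hnorm : 0 ≤ slopeNorm σ n Δ :=
    Finset.sum_nonneg fun k _ => mul_nonneg (muW_nonneg hσ n k) (rearr_nonneg Δ k)
  have hcone := thetaSq_mul_le (X := X) (σ := σ) (s := s) (c₀ := 3) (Δ := Δ)
  set P := ∑ k : Fin p with k.val < s, muW σ n k * rearr Δ k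
  set T := ∑ k : Fin p with s ≤ k.val, muW σ n k * rearr Δ k
  set W := ∑ k : Fin p with k.val < s, muW σ n k ^ 2
  have hW0 : 0 ≤ W := by positivity
  set L := Real.log (2 * Real.exp 1 * p / s)
  have hbound : scaledNorm (X.mulVec βhat - f) ^ 2 + scaledNorm (X.mulVec Δ) ^ 2
      ≤ scaledNorm (X.mulVec β - f) ^ 2 + A * (3 * P - T) := by
    have h1 := mul_le_mul_of_nonneg_left hsplit (by positivity : 0 ≤ 2 * A)
    have h2 := mul_le_mul_of_nonneg_right hA hnorm
    rw [hsum] at h2 hnoise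
    linarith
  rcases le_or_gt T (3 * P) with hTP | hTP
  · have hθΔ := hcone (by linarith)
    set d := Real.sqrt (∑ j, Δ j ^ 2)
    have hd2 : ∑ j, Δ j ^ 2 = d ^ 2 := (Real.sq_sqrt (by positivity)).symm
    rw [hd2] at hθΔ
    set r := Real.sqrt W
    have hr2 : r ^ 2 = W := Real.sq_sqrt hW0
    have hyoung : 3 * A * (r * d) - thetaSq X σ s 3 * d ^ 2
        ≤ 9 * A ^ 2 * W / (4 * thetaSq X σ s 3) := by
      rw [le_div_iff₀ (by positivity), ← hr2]
      nlinarith [sq_nonneg (3 * A * r - 2 * thetaSq X σ s 3 * d)]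
    have hfin : 9 * A ^ 2 * W / (4 * thetaSq X σ s 3)
        ≤ 9 * A ^ 2 * σ ^ 2 * s * L / (4 * n * thetaSq X σ s 3) := by
      calc _ ≤ 9 * A ^ 2 * (σ ^ 2 * s * L / n) / (4 * thetaSq X σ s 3) := by gcongr
        _ = _ := by field_simp
    have hAP := mul_le_mul_of_nonneg_left hcs (by positivity : 0 ≤ 3 * A)
    have hAT : 0 ≤ A * T := by positivity
    linarith
  · have h1 : A * (3 * P - T) ≤ 0 := mul_nonpos_of_nonneg_of_nonpos hA0.le (by linarith)
    have h2 : 0 ≤ 9 * A ^ 2 * σ ^ 2 * s * L / (4 * n * thetaSq X σ s 3) := by positivity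
    linarith [sq_nonneg (scaledNorm (X.mulVec Δ))]
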